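/- Let c > 0 be a fixed constant. Then there exists a constant t > 0 (depending only on c) such that almost surely every rigid component of the Erdős–Rényi random graph G(n, c/n) has size 2, size 3, or size at least t·n. -/

import Mathlib

open MeasureTheory Filter

noncomputable instance {n : ℕ} : MeasurableSpace (SimpleGraph (Fin n)) := ⊤

/-- The Bernoulli(p) measure on `Bool`. -/
noncomputable def bernoulliMeasure (p : ℝ) : Measure Bool :=
  ENNReal.ofReal p • Measure.dirac true + ENNReal.ofReal (1 - p) • Measure.dirac false

/-- The Erdős–Rényi measure on simple graphs on `Fin n`: the pushforward to
`SimpleGraph (Fin n)` of the product Bernoulli(p) measure over unordered pairs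
of distinct vertices. -/
noncomputable def erdosRenyi (n : ℕ) (p : ℝ) : Measure (SimpleGraph (Fin n)) :=
  Measure.map
    (fun f : ({e : Sym2 (Fin n) // ¬ e.IsDiag} → Bool) =>
      SimpleGraph.fromEdgeSet {e : Sym2 (Fin n) | ∃ h : ¬ e.IsDiag, f ⟨e, h⟩ = true})
    (Measure.pi fun _ => bernoulliMeasure p)

/-- The edges of `G` spanned by the vertex set `S`. -/
def spannedEdges {n : ℕ} (G : SimpleGraph (Fin n)) (S : Finset (Fin n)) : Set (Sym2 (Fin n)) :=
  {e | e ∈ G.edgeSet ∧ ∀ v ∈ e, v ∈ S}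

/-- `H` is a (2,3)-tight (Laman) graph on the vertex set `S`: all edges of `H` lie
inside `S`, every subset `T ⊆ S` with `|T| ≥ 2` spans at most `2|T| - 3` edges, and
`H` has exactly `2|S| - 3` edges. -/
def IsTightOn {n : ℕ} (H : SimpleGraph (Fin n)) (S : Finset (Fin n)) : Prop :=
  (∀ e ∈ H.edgeSet, ∀ v ∈ e, v ∈ S) ∧
  (∀ T : Finset (Fin n), T ⊆ S → 2 ≤ T.card →
    (spannedEdges H T).ncard ≤ 2 * T.card - 3) ∧
  H.edgeSet.ncard = 2 * S.card - 3

/-- The induced subgraph `G[S]` is rigid: it contains a spanning (2,3)-tight subgraph. -/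
def IsRigidOn {n : ℕ} (G : SimpleGraph (Fin n)) (S : Finset (Fin n)) : Prop :=
  ∃ H ≤ G, IsTightOn H S

/-- `S` is a rigid component of `G`: `|S| ≥ 2`, `G[S]` is rigid, and `S` is
inclusion-wise maximal with this property. -/
def IsRigidComponent {n : ℕ} (G : SimpleGraph (Fin n)) (S : Finset (Fin n)) : Prop :=
  2 ≤ S.card ∧ IsRigidOn G S ∧
  ∀ S' : Finset (Fin n), S ⊆ S' → IsRigidOn G S' → S' = S

theorem choose_le_exp_mul_div_pow (n : ℕ) {k : ℕ} (hk : 0 < k) :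
    (n.choose k : ℝ) ≤ (Real.exp 1 * n / k) ^ k := by
  have hk' : (0 : ℝ) < k := by exact_mod_cast hk
  calc (n.choose k : ℝ) ≤ (n : ℝ) ^ k / (k.factorial : ℝ) := Nat.choose_le_pow_div k n
    _ = ((n : ℝ) / k) ^ k * ((k : ℝ) ^ k / (k.factorial : ℝ)) := by
        rw [div_pow]; field_simp
    _ ≤ ((n : ℝ) / k) ^ k * Real.exp k := by
        gcongr
        exact Real.pow_div_factorial_le_exp _ hk'.le _
    _ = (Real.exp 1 * n / k) ^ k := by
        rw [← Real.exp_one_pow, ← mul_pow]; ring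

theorem choose_mul_choose_mul_pow_le {c A : ℝ} (hc : 0 < c) (hA : 1 ≤ A) (hcA : c ≤ A)
    {n s N : ℕ} (hn : 0 < n) (hs : 4 ≤ s) (hN : N ≤ s ^ 2) :
    (n.choose s : ℝ) * ((N.choose (2 * s - 3) : ℝ) * (c / n) ^ (2 * s - 3)) ≤
      ((Real.exp 1 ^ 2 * A) ^ 4 * (Real.exp 1 * A) * s / n) ^ (s - 3) := by
  obtain ⟨k, rfl⟩ : ∃ k, s = k + 3 := ⟨s - 3, by omega⟩
  have hm : 2 * (k + 3) - 3 = k + (k + 3) := by omega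
  rw [hm, Nat.add_sub_cancel]
  set s := k + 3 with hs_def
  set E := Real.exp 1
  have hE : 1 ≤ E := Real.one_le_exp zero_le_one
  have hn' : (0 : ℝ) < n := by exact_mod_cast hn
  have hs' : (0 : ℝ) < s := by positivity
  have h₁ : (N.choose (k + s) : ℝ) ≤ (E * s) ^ (k + s) := by
    refine (choose_le_exp_mul_div_pow N (by omega)).trans ?_
    gcongr
    rw [div_le_iff₀ (by positivity)]
    have hNs : (N : ℝ) ≤ (s : ℝ) ^ 2 := by exact_mod_cast hN
    have hks : (s : ℝ) ≤ ((k + s : ℕ) : ℝ) := by push_cast; linarith [k.cast_nonneg (α := ℝ)]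
    calc E * N ≤ E * (s * s) := by gcongr; linarith
      _ ≤ E * s * ((k + s : ℕ) : ℝ) := by rw [← mul_assoc]; gcongr
  have hEA : 1 ≤ E ^ 2 * A := one_le_mul_of_one_le_of_one_le (one_le_pow₀ hE) hA
  calc (n.choose s : ℝ) * ((N.choose (k + s) : ℝ) * (c / n) ^ (k + s))
      ≤ (E * n / s) ^ s * ((E * s) ^ (k + s) * (c / n) ^ (k + s)) := by
        gcongr
        exact choose_le_exp_mul_div_pow n (by omega)
    _ = ((E * n / s) * (E * s * (c / n))) ^ s * (E * s * (c / n)) ^ k := by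
        rw [← mul_pow, mul_pow (E * n / s), pow_add]; ring
    _ = (E ^ 2 * c) ^ s * (E * s * (c / n)) ^ k := by
        congr 2; field_simp
    _ ≤ (E ^ 2 * A) ^ (4 * k) * (E * s * (A / n)) ^ k := by
        gcongr ?_ * (E * s * (?_ / n)) ^ k
        calc (E ^ 2 * c) ^ s ≤ (E ^ 2 * A) ^ s := by gcongr
          _ ≤ (E ^ 2 * A) ^ (4 * k) := pow_le_pow_right₀ hEA (by omega)
    _ = ((E ^ 2 * A) ^ 4 * (E * A) * s / n) ^ k := by
        rw [pow_mul, ← mul_pow]; congr 1; ring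

theorem sum_mul_div_pow_le {D : ℝ} (hD : 0 < D) {n : ℕ} (hn : 0 < n) (I : Finset ℕ)
    (hI : ∀ s ∈ I, 4 ≤ s ∧ D * s / n ≤ 1 / 2) :
    ∑ s ∈ I, (D * s / n) ^ (s - 3) ≤ 16 * D * (∑' s : ℕ, (s : ℝ) * (1 / 2 : ℝ) ^ s) / n := by
  have hn' : (0 : ℝ) < n := by exact_mod_cast hn
  have hsum : Summable fun s : ℕ => (s : ℝ) * (1 / 2 : ℝ) ^ s := by
    simpa using summable_pow_mul_geometric_of_norm_lt_one 1
      (show ‖(1 / 2 : ℝ)‖ < 1 by norm_num)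
  calc ∑ s ∈ I, (D * s / n) ^ (s - 3)
      ≤ ∑ s ∈ I, 16 * D / n * ((s : ℝ) * (1 / 2 : ℝ) ^ s) := by
        refine Finset.sum_le_sum fun s hs => ?_
        obtain ⟨h4, hle⟩ := hI s hs
        obtain ⟨k, rfl⟩ : ∃ k, s = k + 4 := ⟨s - 4, by omega⟩
        have : k + 4 - 3 = k + 1 := by omega
        rw [this, pow_succ]
        calc (D * ((k + 4 : ℕ) : ℝ) / n) ^ k * (D * ((k + 4 : ℕ) : ℝ) / n)
            ≤ (1 / 2 : ℝ) ^ k * (D * ((k + 4 : ℕ) : ℝ) / n) := by gcongr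
          _ = 16 * D / n * (((k + 4 : ℕ) : ℝ) * (1 / 2 : ℝ) ^ (k + 4)) := by
            rw [pow_add]; ring
    _ = 16 * D / n * ∑ s ∈ I, (s : ℝ) * (1 / 2 : ℝ) ^ s := by rw [Finset.mul_sum]
    _ ≤ 16 * D / n * ∑' s : ℕ, (s : ℝ) * (1 / 2 : ℝ) ^ s := by
        gcongr
        exact hsum.sum_le_tsum _ fun s _ => by positivity
    _ = _ := by ring

theorem isProbabilityMeasure_bernoulliMeasure {p : ℝ} (h₀ : 0 ≤ p) (h₁ : p ≤ 1) :
    IsProbabilityMeasure (bernoulliMeasure p) := by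
  refine ⟨?_⟩
  simp only [bernoulliMeasure, Measure.add_apply, Measure.smul_apply, measure_univ, smul_eq_mul,
    mul_one]
  rw [← ENNReal.ofReal_add h₀ (by linarith)]
  simp

theorem bernoulliMeasure_singleton_true (p : ℝ) :
    bernoulliMeasure p {true} = ENNReal.ofReal p := by
  simp [bernoulliMeasure]

theorem pi_bernoulliMeasure_forall_mem_eq_true {ι : Type*} [Fintype ι] {p : ℝ}
    (h₀ : 0 ≤ p) (h₁ : p ≤ 1) (F : Finset ι) :
    Measure.pi (fun _ : ι => bernoulliMeasure p) {f | ∀ e ∈ F, f e = true} =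
      ENNReal.ofReal p ^ F.card := by
  classical
  have := isProbabilityMeasure_bernoulliMeasure h₀ h₁
  have hset : {f : ι → Bool | ∀ e ∈ F, f e = true} =
      Set.univ.pi fun e => if e ∈ F then {true} else Set.univ := by
    ext f
    simp only [Set.mem_ofPred_eq, Set.mem_pi, Set.mem_univ, true_implies]
    refine forall_congr' fun e => ?_
    by_cases he : e ∈ F <;> simp [he]
  rw [hset, Measure.pi_pi]
  simp only [apply_ite (bernoulliMeasure p), bernoulliMeasure_singleton_true, measure_univ]
  simp

theorem isProbabilityMeasure_erdosRenyi (n : ℕ) {p : ℝ} (h₀ : 0 ≤ p) (h₁ : p ≤ 1) :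
    IsProbabilityMeasure (erdosRenyi n p) := by
  have := isProbabilityMeasure_bernoulliMeasure h₀ h₁
  exact Measure.isProbabilityMeasure_map Measurable.of_discrete.aemeasurable

/-- The potential edges with both endpoints in `S`. -/
noncomputable def pairsIn {n : ℕ} (S : Finset (Fin n)) :
    Finset {e : Sym2 (Fin n) // ¬ e.IsDiag} :=
  S.sym2.subtype fun e => ¬ e.IsDiag

theorem card_pairsIn_le {n : ℕ} (S : Finset (Fin n)) : (pairsIn S).card ≤ S.card ^ 2 := by
  rw [pairsIn, Finset.card_subtype]
  refine (Finset.card_filter_le _ _).trans ?_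
  rw [Finset.card_sym2, Nat.choose_two_right, Nat.add_sub_cancel]
  refine Nat.div_le_of_le_mul ?_
  nlinarith [Nat.le_self_pow two_ne_zero S.card]

theorem IsRigidOn.exists_finset_pairsIn {n : ℕ} {G : SimpleGraph (Fin n)} {S : Finset (Fin n)}
    (h : IsRigidOn G S) :
    ∃ F ∈ (pairsIn S).powersetCard (2 * S.card - 3), ∀ e ∈ F, e.1 ∈ G.edgeSet := by
  classical
  obtain ⟨H, hHG, hHS, -, hcard⟩ := h
  refine ⟨H.edgeFinset.subtype fun e => ¬ e.IsDiag, ?_, ?_⟩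
  · rw [Finset.mem_powersetCard]
    constructor
    · intro e he
      simp only [pairsIn, Finset.mem_subtype, SimpleGraph.mem_edgeFinset, Finset.mem_sym2_iff]
        at he ⊢
      exact hHS e he
    · rw [Finset.card_subtype, Finset.filter_true_of_mem, ← hcard,
        ← SimpleGraph.coe_edgeFinset, Set.ncard_coe_finset]
      intro e he
      exact H.not_isDiag_of_mem_edgeSet (SimpleGraph.mem_edgeFinset.mp he)
  · intro e he
    simp only [Finset.mem_subtype, SimpleGraph.mem_edgeFinset] at he
    exact SimpleGraph.edgeSet_mono hHG he

theorem erdosRenyi_forall_mem_edgeSet {n : ℕ} {p : ℝ} (h₀ : 0 ≤ p) (h₁ : p ≤ 1)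
    (F : Finset {e : Sym2 (Fin n) // ¬ e.IsDiag}) :
    erdosRenyi n p {G | ∀ e ∈ F, e.1 ∈ G.edgeSet} = ENNReal.ofReal p ^ F.card := by
  rw [erdosRenyi, Measure.map_apply Measurable.of_discrete (MeasurableSpace.measurableSet_top),
    ← pi_bernoulliMeasure_forall_mem_eq_true h₀ h₁]
  congr 1
  ext f
  simp only [Set.mem_preimage, Set.mem_ofPred_eq, SimpleGraph.edgeSet_fromEdgeSet, Set.mem_sdiff]
  refine forall₂_congr fun e _ => ?_
  simp [e.2]

theorem erdosRenyi_exists_isRigidOn_le {c A : ℝ} (hc : 0 < c) (hA : 1 ≤ A) (hcA : c ≤ A)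
    {n : ℕ} (hn : 0 < n) (hcn : c / n ≤ 1) (I : Finset ℕ) (hI : ∀ s ∈ I, 4 ≤ s) :
    erdosRenyi n (c / n) {G | ∃ S : Finset (Fin n), S.card ∈ I ∧ IsRigidOn G S} ≤
      ENNReal.ofReal (∑ s ∈ I,
        ((Real.exp 1 ^ 2 * A) ^ 4 * (Real.exp 1 * A) * s / n) ^ (s - 3)) := by
  have hp : 0 ≤ c / n := by positivity
  have hsub : {G : SimpleGraph (Fin n) | ∃ S : Finset (Fin n), S.card ∈ I ∧ IsRigidOn G S} ⊆
      ⋃ s ∈ I, ⋃ S ∈ (Finset.univ : Finset (Fin n)).powersetCard s,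
        ⋃ F ∈ (pairsIn S).powersetCard (2 * s - 3), {G | ∀ e ∈ F, e.1 ∈ G.edgeSet} := by
    rintro G ⟨S, hS, hG⟩
    obtain ⟨F, hF, hFG⟩ := hG.exists_finset_pairsIn
    simp only [Set.mem_iUnion]
    exact ⟨S.card, hS, S, Finset.mem_powersetCard.mpr ⟨Finset.subset_univ _, rfl⟩, F, hF, hFG⟩
  refine (measure_mono hsub).trans ((measure_biUnion_finset_le _ _).trans ?_)
  rw [ENNReal.ofReal_sum_of_nonneg fun s _ => by positivity]
  refine Finset.sum_le_sum fun s hs => ?_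
  have hS : ∀ S ∈ (Finset.univ : Finset (Fin n)).powersetCard s,
      erdosRenyi n (c / n) (⋃ F ∈ (pairsIn S).powersetCard (2 * s - 3),
        {G | ∀ e ∈ F, e.1 ∈ G.edgeSet}) ≤
      ENNReal.ofReal (((s ^ 2).choose (2 * s - 3) : ℝ) * (c / n) ^ (2 * s - 3)) := by
    intro S hS
    rw [Finset.mem_powersetCard] at hS
    calc _ ≤ ∑ F ∈ (pairsIn S).powersetCard (2 * s - 3),
          erdosRenyi n (c / n) {G | ∀ e ∈ F, e.1 ∈ G.edgeSet} := measure_biUnion_finset_le _ _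
      _ = ∑ F ∈ (pairsIn S).powersetCard (2 * s - 3),
          ENNReal.ofReal ((c / n) ^ (2 * s - 3)) := by
        refine Finset.sum_congr rfl fun F hF => ?_
        rw [erdosRenyi_forall_mem_edgeSet hp hcn, (Finset.mem_powersetCard.mp hF).2,
          ENNReal.ofReal_pow hp]
      _ = ENNReal.ofReal
          (((pairsIn S).card.choose (2 * s - 3) : ℝ) * (c / n) ^ (2 * s - 3)) := by
        rw [Finset.sum_const, Finset.card_powersetCard, nsmul_eq_mul,
          ENNReal.ofReal_mul (Nat.cast_nonneg _), ENNReal.ofReal_natCast]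
      _ ≤ _ := by
        refine ENNReal.ofReal_le_ofReal ?_
        have := hS.2 ▸ card_pairsIn_le S
        gcongr
  calc _ ≤ ∑ S ∈ (Finset.univ : Finset (Fin n)).powersetCard s,
        erdosRenyi n (c / n) (⋃ F ∈ (pairsIn S).powersetCard (2 * s - 3),
          {G | ∀ e ∈ F, e.1 ∈ G.edgeSet}) := measure_biUnion_finset_le _ _
    _ ≤ _ := Finset.sum_le_sum hS
    _ = ENNReal.ofReal ((n.choose s : ℝ) *
        (((s ^ 2).choose (2 * s - 3) : ℝ) * (c / n) ^ (2 * s - 3))) := by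
      rw [Finset.sum_const, Finset.card_powersetCard, nsmul_eq_mul, Finset.card_fin,
        ENNReal.ofReal_mul (p := (n.choose s : ℝ)) (Nat.cast_nonneg _), ENNReal.ofReal_natCast]
    _ ≤ _ := ENNReal.ofReal_le_ofReal
      (choose_mul_choose_mul_pow_le hc hA hcA hn (hI s hs) le_rfl)

/-- For a fixed constant `c > 0`, there is a constant `t > 0` such that almost surely
every rigid component of `G(n, c/n)` has size 2, size 3, or size at least `t·n`. -/
theorem rigid_components_constant_or_linear (c : ℝ) (hc : 0 < c) :
    ∃ t : ℝ, 0 < t ∧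
      Tendsto (fun n : ℕ =>
        erdosRenyi n (c / n)
          {G | ∀ S : Finset (Fin n), IsRigidComponent G S →
            S.card = 2 ∨ S.card = 3 ∨ t * n ≤ (S.card : ℝ)})
        atTop (nhds 1) := by
  set A := max 1 c
  have hA : 1 ≤ A := le_max_left _ _
  set D := (Real.exp 1 ^ 2 * A) ^ 4 * (Real.exp 1 * A) with hD_def
  have hD : 0 < D := by positivity
  refine ⟨1 / (2 * D), by positivity, ?_⟩
  set K := 16 * D * ∑' s : ℕ, (s : ℝ) * (1 / 2 : ℝ) ^ s
  have hlim : Tendsto (fun n : ℕ => 1 - ENNReal.ofReal (K / n)) atTop (nhds 1) := by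
    have h := ENNReal.Tendsto.sub (tendsto_const_nhds (x := (1 : ENNReal)) (f := atTop))
      (ENNReal.tendsto_ofReal (tendsto_const_div_atTop_nhds_zero_nat K)) (Or.inl ENNReal.one_ne_top)
    simpa using h
  have hlarge : ∀ᶠ n : ℕ in atTop, 0 < n ∧ c / n ≤ 1 := by
    filter_upwards [eventually_gt_atTop 0, eventually_ge_atTop ⌈c⌉₊] with n hn hcn
    have hn' : (0 : ℝ) < n := by exact_mod_cast hn
    exact ⟨hn, (div_le_one hn').mpr (Nat.ceil_le.mp hcn)⟩
  refine tendsto_of_tendsto_of_tendsto_of_le_of_le' hlim tendsto_const_nhds ?_ ?_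
  · filter_upwards [hlarge] with n ⟨hn, hcn⟩
    have hn' : (0 : ℝ) < n := by exact_mod_cast hn
    have := isProbabilityMeasure_erdosRenyi n (show 0 ≤ c / n by positivity) hcn
    set I := (Finset.range (n + 1)).filter fun s : ℕ => 4 ≤ s ∧ D * s / n ≤ 1 / 2
    have hI : ∀ s ∈ I, 4 ≤ s ∧ D * s / n ≤ 1 / 2 := fun s hs => (Finset.mem_filter.mp hs).2
    have hbad := (erdosRenyi_exists_isRigidOn_le hc hA (le_max_right 1 c) hn hcn I
      fun s hs => (hI s hs).1).trans
        (ENNReal.ofReal_le_ofReal (sum_mul_div_pow_le hD hn I hI))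
    refine (tsub_le_tsub_left hbad 1).trans ?_
    rw [← prob_compl_eq_one_sub MeasurableSpace.measurableSet_top]
    refine measure_mono fun G hG S hS => ?_
    by_contra! hcon
    refine hG ⟨S, Finset.mem_filter.mpr ⟨?_, ?_, ?_⟩, hS.2.1⟩
    · have := S.card_le_univ
      rw [Fintype.card_fin] at this
      exact Finset.mem_range.mpr (by omega)
    · have := hS.1
      omega
    · rw [div_le_iff₀ hn']
      have h := hcon.2.2.le
      rw [div_mul_eq_mul_div, one_mul, le_div_iff₀ (by positivity)] at h
      linarith
  · filter_upwards [hlarge] with n ⟨hn, hcn⟩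
    have := isProbabilityMeasure_erdosRenyi n (show 0 ≤ c / n by positivity) hcn
    exact prob_le_one
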